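/- arXiv:1911.00961 — 2 statements merged into one kernel-verified Lean document; each statement's English description precedes it below -/
import Mathlib

section
/- Let n ≥ 1 and u' ∈ ℝⁿ. Let f₁, …, f_k : ℝⁿ → ℝ be linear functionals such that fᵢ(u') ≠ 0 for every i, and such that fᵢ and f_j are linearly independent whenever i ≠ j. Then the set of u ∈ ℝⁿ for which there exist indices i ≠ j and a point p in the segment [u, u'] with fᵢ(p) = 0 and f_j(p) = 0 has Lebesgue measure zero. -/
open MeasureTheory

/-- A linear functional on a real vector space that vanishes at `y` and at a point of the segment
`[x, y]` where some functional nonvanishing at `y` vanishes, also vanishes at `x`. -/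
theorem LinearMap.eq_zero_left_of_mem_segment {E : Type*} [AddCommGroup E] [Module ℝ E]
    {f g : E →ₗ[ℝ] ℝ} {x y p : E} (hp : p ∈ segment ℝ x y) (hfy : f y ≠ 0) (hfp : f p = 0)
    (hgy : g y = 0) (hgp : g p = 0) : g x = 0 := by
  obtain ⟨a, b, -, -, hab, rfl⟩ := hp
  have ha : a ≠ 0 := by
    rintro rfl
    obtain rfl : b = 1 := by linarith
    exact hfy (by simpa using hfp)
  simpa [hgy, ha] using hgp

/-- The kernel of a nonzero linear functional has measure zero. -/
theorem MeasureTheory.Measure.addHaar_ker_eq_zero {E : Type*} [NormedAddCommGroup E]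
    [NormedSpace ℝ E] [MeasurableSpace E] [BorelSpace E] [FiniteDimensional ℝ E] (μ : Measure E)
    [μ.IsAddHaarMeasure] {g : E →ₗ[ℝ] ℝ} (hg : g ≠ 0) : μ {x | g x = 0} = 0 :=
  Measure.addHaar_submodule μ (LinearMap.ker g) (mt LinearMap.ker_eq_top.mp hg)

/-- Let `f₁, …, f_k` be linear functionals on `ℝⁿ`, none vanishing at `u'` and
pairwise linearly independent. Then the set of `u` for which some point of the
segment `[u, u']` lies on two distinct walls `ker fᵢ`, `ker f_j` has Lebesgue
measure zero. -/
theorem generic_position_ae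
    (n : ℕ) (hn : 1 ≤ n) (u' : Fin n → ℝ)
    (k : ℕ) (f : Fin k → (Fin n → ℝ) →ₗ[ℝ] ℝ)
    (hne : ∀ i, f i u' ≠ 0)
    (hind : ∀ i j, i ≠ j → LinearIndependent ℝ ![f i, f j]) :
    volume {u : Fin n → ℝ |
      ∃ i j, i ≠ j ∧ ∃ p ∈ segment ℝ u u', f i p = 0 ∧ f j p = 0} = 0 := by
  let g (i j : Fin k) : (Fin n → ℝ) →ₗ[ℝ] ℝ := f j u' • f i - f i u' • f j
  have hg (i j : Fin k) (hij : i ≠ j) : g i j ≠ 0 := fun h ↦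
    hne j (LinearIndependent.pair_iff.mp (hind i j hij) (f j u') (-f i u')
      (by rw [neg_smul, ← sub_eq_add_neg]; exact h)).1
  refine measure_mono_null (t := ⋃ (i) (j) (_ : i ≠ j), {u | g i j u = 0}) ?_ ?_
  · rintro u ⟨i, j, hij, p, hp, hi, hj⟩
    simp only [Set.mem_iUnion]
    exact ⟨i, j, hij, LinearMap.eq_zero_left_of_mem_segment hp (hne i) hi
      (by simp [g, mul_comm]) (by simp [g, hi, hj])⟩
  · simp only [measure_iUnion_null_iff]
    exact fun i j hij ↦ Measure.addHaar_ker_eq_zero volume (hg i j hij)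
end

section
/- Let f₁, …, f_k : E → ℝ be linear functionals on a real vector space E and let u, u' ∈ E satisfy fᵢ(u) ≠ 0 and fᵢ(u') ≠ 0 for every i. Suppose there is at most one index j such that the segment [u, u'] meets ker f_j. Then the sets {i : fᵢ(u) > 0} and {i : fᵢ(u') > 0} are comparable: one of them is contained in the other. -/
/-- A linear functional vanishes somewhere on `segment ℝ u v` iff `0` lies between its values at
the endpoints. -/
theorem LinearMap.exists_mem_segment_eq_zero_iff {E : Type*} [AddCommGroup E] [Module ℝ E]
    (f : E →ₗ[ℝ] ℝ) (u v : E) :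
    (∃ p ∈ segment ℝ u v, f p = 0) ↔ 0 ∈ Set.uIcc (f u) (f v) := by
  rw [← segment_eq_uIcc, ← f.coe_toAffineMap, ← image_segment]
  rfl

/-- If the segment `[u, u']` meets at most one of the walls `ker f_j`, then the
sets of indices on which `f` is positive at `u` and at `u'` are comparable. -/
theorem comparable_of_at_most_one_wall
    {E : Type*} [AddCommGroup E] [Module ℝ E]
    (k : ℕ) (f : Fin k → E →ₗ[ℝ] ℝ) (u u' : E)
    (hu : ∀ i, f i u ≠ 0) (hu' : ∀ i, f i u' ≠ 0)
    (hone : ∀ j j' : Fin k, (∃ p ∈ segment ℝ u u', f j p = 0) →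
      (∃ p ∈ segment ℝ u u', f j' p = 0) → j = j') :
    ({i | 0 < f i u} : Set (Fin k)) ⊆ {i | 0 < f i u'} ∨
      ({i | 0 < f i u'} : Set (Fin k)) ⊆ {i | 0 < f i u} := by
  by_contra! h
  obtain ⟨⟨i, hi, hi'⟩, ⟨j, hj', hj⟩⟩ := And.imp Set.not_subset.1 Set.not_subset.1 h
  simp only [Set.mem_ofPred_eq, not_lt] at hi hi' hj hj'
  have hij : i = j := hone i j
    (((f i).exists_mem_segment_eq_zero_iff u u').2 (Set.mem_uIcc.2 (.inr ⟨hi', hi.le⟩)))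
    (((f j).exists_mem_segment_eq_zero_iff u u').2 (Set.mem_uIcc.2 (.inl ⟨hj, hj'.le⟩)))
  subst hij
  exact hi.not_ge hj
end
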